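/- Let λ > 0 and let φ be the (real-valued) solution of the Schrödinger equation with spectral parameter λ on [0,∞) determined by the initial conditions φ(0) = 0 and φ'(0) = 1. Then there exist constants κ > 0 and η ∈ ℝ such that φ(x) − (κ/(√(p₀λ)·K(λ)))·sin(Φ(x,λ) − η) → 0 as x → ∞. -/

import Mathlib

open MeasureTheory Filter Set Complex

noncomputable section

/-- The principal-branch square root `ω(x,z) = ((q x − z)/p x)^{1/2}`. -/
def omg (p q : ℝ → ℝ) (z : ℂ) (x : ℝ) : ℂ :=
  (((q x : ℂ) - z) / (p x : ℂ)) ^ (1 / 2 : ℂ)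

/-- `Ω(x,z) = ∫₀ˣ ω(y,z) dy`. -/
def Omg (p q : ℝ → ℝ) (z : ℂ) (x : ℝ) : ℂ :=
  ∫ y in (0:ℝ)..x, omg p q z y

/-- `a(x,z) = exp(−Ω(x,z))`. -/
def aa (p q : ℝ → ℝ) (z : ℂ) (x : ℝ) : ℂ :=
  Complex.exp (-(Omg p q z x))

/-- Assumption (PQ): `p > 0` on `[0,∞)`, locally absolutely continuous with integrable
derivative `p'` and limit `p₀ > 0` at `+∞`; `q` integrable on `(0,x₀)`, locally absolutely
continuous on `[x₀,∞)` with integrable derivative `q'` there, and `q → 0` at `+∞`.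
Absolute continuity is encoded by the fundamental theorem of calculus representation. -/
structure PQData (p p' q q' : ℝ → ℝ) (p₀ x₀ : ℝ) : Prop where
  p_pos : ∀ x : ℝ, 0 ≤ x → 0 < p x
  hp₀ : 0 < p₀
  hx₀ : 0 ≤ x₀
  p_ac : ∀ x : ℝ, 0 ≤ x → p x = p 0 + ∫ t in (0:ℝ)..x, p' t
  p'_int : IntegrableOn p' (Ioi (0:ℝ))
  p_lim : Tendsto p atTop (nhds p₀)
  q_int : IntegrableOn q (Ioo (0:ℝ) x₀)
  q_ac : ∀ x : ℝ, x₀ ≤ x → q x = q x₀ + ∫ t in x₀..x, q' t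
  q'_int : IntegrableOn q' (Ioi x₀)
  q_lim : Tendsto q atTop (nhds (0:ℝ))

/-- `f` (with derivative `f'`) solves `−(p f')' + q f = z f` on `I`:
`f` is differentiable on `I` with derivative `f'`, and `p·f'` is locally absolutely
continuous on `I` with a.e. derivative `(q − z)·f` (encoded via the FTC representation). -/
def IsSol (p q : ℝ → ℝ) (z : ℂ) (I : Set ℝ) (f f' : ℝ → ℂ) : Prop :=
  (∀ x ∈ I, HasDerivWithinAt f (f' x) I x) ∧
    ∀ x ∈ I, ∀ y ∈ I,
      (p y : ℂ) * f' y - (p x : ℂ) * f' x = ∫ t in x..y, ((q t : ℂ) - z) * f t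

/-- `ε(x) = ∫ₓ^∞ (|p'| + |q'|)`. -/
def eps (p' q' : ℝ → ℝ) (x : ℝ) : ℝ :=
  ∫ y in Ioi x, (|p' y| + |q' y|)

/-- The Volterra kernel `G(x,y,z) = a(y,z)² ∫ₓ^y p(s)⁻¹ a(s,z)⁻² ds`. -/
def Gker (p q : ℝ → ℝ) (z : ℂ) (x y : ℝ) : ℂ :=
  aa p q z y ^ 2 * ∫ s in x..y, ((p s : ℂ))⁻¹ * (aa p q z s ^ 2)⁻¹

/-- `Φ(x,λ) = ∫₀ˣ √(max((λ − q)/p, 0))`. -/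
def Phi (p q : ℝ → ℝ) (lam x : ℝ) : ℝ :=
  ∫ y in (0:ℝ)..x, Real.sqrt (max ((lam - q y) / p y) 0)

/-- `K(λ) = exp(−∫₀^∞ √(max((q − λ)/p, 0)))`. -/
def Kc (p q : ℝ → ℝ) (lam : ℝ) : ℝ :=
  Real.exp (-∫ y in Ioi (0:ℝ), Real.sqrt (max ((q y - lam) / p y) 0))

/-- `ξ(x) = θ(x)·∫_ϱ^x θ(y)⁻² p(y)⁻¹ dy`. -/
def xiFun (p : ℝ → ℝ) (θ : ℝ → ℂ) (ϱ x : ℝ) : ℂ :=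
  θ x * ∫ y in ϱ..x, (θ y ^ 2)⁻¹ * ((p y : ℂ))⁻¹

/-- The derivative of `ξ`: `ξ'(x) = θ'(x)·∫_ϱ^x θ⁻² p⁻¹ + θ(x)⁻¹ p(x)⁻¹`. -/
def xiFun' (p : ℝ → ℝ) (θ θ' : ℝ → ℂ) (ϱ x : ℝ) : ℂ :=
  θ' x * (∫ y in ϱ..x, (θ y ^ 2)⁻¹ * ((p y : ℂ))⁻¹) + (θ x)⁻¹ * ((p x : ℂ))⁻¹

/-- `f` is the integral of `g` on `[a,∞)`. -/
structure ACD (a : ℝ) (f g : ℝ → ℝ) : Prop where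
  int : ∀ b, a ≤ b → IntervalIntegrable g volume a b
  eq : ∀ x, a ≤ x → f x = f a + ∫ t in a..x, g t

lemma ac_congr {f g : ℝ → ℝ} {a b : ℝ} (h : AbsolutelyContinuousOnInterval f a b)
    (hfg : ∀ x ∈ uIcc a b, g x = f x) : AbsolutelyContinuousOnInterval g a b := by
  rw [absolutelyContinuousOnInterval_iff] at h ⊢
  intro ε hε
  obtain ⟨δ, hδ, H⟩ := h ε hε
  refine ⟨δ, hδ, fun E hE hE' => ?_⟩
  refine lt_of_le_of_lt (le_of_eq ?_) (H E hE hE')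
  refine Finset.sum_congr rfl fun i hi => ?_
  have := hE.1 i hi
  rw [hfg _ this.1, hfg _ this.2]

lemma ac_lip {f G : ℝ → ℝ} {a b : ℝ} {K : NNReal} {s : Set ℝ}
    (h : AbsolutelyContinuousOnInterval f a b)
    (hs : ∀ x ∈ uIcc a b, f x ∈ s) (hG : LipschitzOnWith K G s) :
    AbsolutelyContinuousOnInterval (fun x => G (f x)) a b := by
  rw [absolutelyContinuousOnInterval_iff] at h ⊢
  intro ε hε
  obtain ⟨δ, hδ, H⟩ := h (ε / (K + 1)) (by positivity)
  refine ⟨δ, hδ, fun E hE hE' => ?_⟩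
  have h1 := H E hE hE'
  have hK : (0:ℝ) < K + 1 := by positivity
  rw [lt_div_iff₀ hK] at h1
  refine lt_of_le_of_lt ?_ h1
  rw [Finset.sum_mul]
  refine Finset.sum_le_sum fun i hi => ?_
  have h3 := hE.1 i hi
  have h2 := hG.dist_le_mul _ (hs _ h3.1) _ (hs _ h3.2)
  have : 0 ≤ dist (f (E.2 i).1) (f (E.2 i).2) := dist_nonneg
  nlinarith

namespace ACD

variable {a : ℝ} {f f' g g' : ℝ → ℝ}

lemma ac (h : ACD a f f') {b : ℝ} (hb : a ≤ b) : AbsolutelyContinuousOnInterval f a b := by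
  have h1 := (h.int b hb).absolutelyContinuousOnInterval_intervalIntegral (c := a) (by simp)
  have h2 : AbsolutelyContinuousOnInterval (fun _ : ℝ => f a) a b :=
    ((LipschitzWith.const (f a)).lipschitzOnWith (s := uIcc a b)).absolutelyContinuousOnInterval
  refine ac_congr (h2.fun_add h1) ?_
  intro x hx
  rw [uIcc_of_le hb] at hx
  exact h.eq x hx.1

lemma cont (h : ACD a f f') : ContinuousOn f (Ici a) := by
  intro x hx
  have h1 := (h.ac (b := x + 1) (by have := mem_Ici.1 hx; linarith)).continuousOn
  rw [uIcc_of_le (by have := mem_Ici.1 hx; linarith)] at h1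
  have h2 := h1 x ⟨hx, by linarith⟩
  refine h2.mono_of_mem_nhdsWithin ?_
  rw [mem_nhdsWithin]
  exact ⟨Iio (x+1), isOpen_Iio, by simp, fun y hy => ⟨hy.2, le_of_lt hy.1⟩⟩

lemma ae_deriv (h : ACD a f f') : ∀ᵐ x, a < x → HasDerivAt f (f' x) x := by
  have h1 : ∀ n : ℕ, ∀ᵐ x, x ∈ uIcc a (a + n) →
      HasDerivAt (fun y => ∫ t in a..y, f' t) (f' x) x := by
    intro n
    filter_upwards [(h.int (a + n) (by simp)).ae_hasDerivAt_integral] with x hx hx'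
    exact hx hx' a (by simp)
  filter_upwards [ae_all_iff.2 h1] with x hx hax
  obtain ⟨n, hn⟩ := exists_nat_gt (x - a)
  have h2 := hx n (by rw [uIcc_of_le (by simp)]; exact ⟨hax.le, by linarith⟩)
  have h3 := h2.const_add (f a)
  refine h3.congr_of_eventuallyEq ?_
  filter_upwards [lt_mem_nhds hax] with y hy
  exact h.eq y hy.le

lemma of_ac (h : ∀ b, a ≤ b → AbsolutelyContinuousOnInterval f a b)
    (hd : ∀ᵐ x, a < x → HasDerivAt f (f' x) x) : ACD a f f' := by
  have key : ∀ b, a ≤ b → ∀ᵐ x, x ∈ uIoc a b → deriv f x = f' x := by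
    intro b hb
    filter_upwards [hd] with x hx hx'
    rw [uIoc_of_le hb] at hx'
    exact (hx hx'.1).deriv
  refine ⟨fun b hb => ?_, fun x hx => ?_⟩
  · refine (h b hb).intervalIntegrable_deriv.congr_ae ?_
    rw [EventuallyEq, ae_restrict_iff' measurableSet_uIoc]
    exact key b hb
  · rw [← intervalIntegral.integral_congr_ae (key x hx), (h x hx).integral_deriv_eq_sub]
    ring

lemma congr (h : ACD a f f') (h1 : ∀ x, a ≤ x → g x = f x) (h2 : ∀ x, a ≤ x → g' x = f' x) :
    ACD a g g' := by
  refine of_ac (fun b hb => ac_congr (h.ac hb) ?_) ?_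
  · intro x hx
    rw [uIcc_of_le hb] at hx
    exact h1 x hx.1
  · filter_upwards [h.ae_deriv] with x hx hax
    rw [h2 x hax.le]
    refine (hx hax).congr_of_eventuallyEq ?_
    filter_upwards [lt_mem_nhds hax] with y hy
    exact h1 y hy.le

lemma mono (h : ACD a f f') {b : ℝ} (hab : a ≤ b) : ACD b f f' := by
  refine of_ac (fun c hc => (h.ac (hab.trans hc)).mono ?_) ?_
  · rw [uIcc_of_le hc, uIcc_of_le (hab.trans hc)]
    exact Icc_subset_Icc_left hab
  · filter_upwards [h.ae_deriv] with x hx hbx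
    exact hx (hab.trans_lt hbx)

lemma add (h : ACD a f f') (k : ACD a g g') :
    ACD a (fun x => f x + g x) (fun x => f' x + g' x) := by
  refine of_ac (fun b hb => (h.ac hb).fun_add (k.ac hb)) ?_
  filter_upwards [h.ae_deriv, k.ae_deriv] with x hx hx' hax
  exact (hx hax).add (hx' hax)

lemma sub (h : ACD a f f') (k : ACD a g g') :
    ACD a (fun x => f x - g x) (fun x => f' x - g' x) := by
  refine of_ac (fun b hb => (h.ac hb).fun_sub (k.ac hb)) ?_
  filter_upwards [h.ae_deriv, k.ae_deriv] with x hx hx' hax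
  exact (hx hax).sub (hx' hax)

lemma mul (h : ACD a f f') (k : ACD a g g') :
    ACD a (fun x => f x * g x) (fun x => f' x * g x + f x * g' x) := by
  refine of_ac (fun b hb => (h.ac hb).fun_mul (k.ac hb)) ?_
  filter_upwards [h.ae_deriv, k.ae_deriv] with x hx hx' hax
  exact (hx hax).mul (hx' hax)

lemma const (c : ℝ) : ACD a (fun _ => c) (fun _ => 0) := by
  refine ⟨fun b _ => by simp, fun x _ => by simp⟩

lemma comp {G G' : ℝ → ℝ} {s : Set ℝ} (h : ACD a f f') (hs : ∀ x, a ≤ x → f x ∈ s)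
    (hG : ContDiffOn ℝ 1 G s) (hG' : ∀ y ∈ s, HasDerivAt G (G' y) y) :
    ACD a (fun x => G (f x)) (fun x => G' (f x) * f' x) := by
  refine of_ac (fun b hb => ?_) ?_
  · have hc := (h.ac hb).continuousOn
    have hsub : f '' (uIcc a b) ⊆ s := by
      rintro _ ⟨x, hx, rfl⟩
      rw [uIcc_of_le hb] at hx
      exact hs x hx.1
    have hcpt : IsCompact (f '' (uIcc a b)) := isCompact_uIcc.image_of_continuousOn hc
    have hconv : Convex ℝ (f '' (uIcc a b)) :=
      ((isPreconnected_uIcc).image f hc).ordConnected.convex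
    obtain ⟨K, hK⟩ := (hG.mono hsub).exists_lipschitzOnWith (by decide) hconv hcpt
    exact ac_lip (h.ac hb) (fun x hx => mem_image_of_mem f hx) hK
  · filter_upwards [h.ae_deriv] with x hx hax
    exact (hG' _ (hs x hax.le)).comp x (hx hax)

lemma le_of_nonneg (h : ACD a f f') (h0 : ∀ x, a ≤ x → 0 ≤ f' x) {b : ℝ} (hb : a ≤ b) :
    f a ≤ f b := by
  rw [h.eq b hb]
  have := intervalIntegral.integral_nonneg hb (f := f') (μ := volume) (fun x hx => h0 x hx.1)
  linarith

/-- Gronwall type inequality. -/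
lemma gronwall {m : ℝ → ℝ} (h : ACD a f f') (hm : ∀ b, a ≤ b → IntervalIntegrable m volume a b)
    (hb : ∀ x, a ≤ x → |f' x| ≤ m x * f x) {b : ℝ} (hab : a ≤ b) :
    f a ≤ f b * Real.exp (∫ t in a..b, m t) ∧ f b ≤ f a * Real.exp (∫ t in a..b, m t) := by
  have hM : ACD a (fun x => ∫ t in a..x, m t) m := ⟨hm, fun x _ => by simp⟩
  have hE : ACD a (fun x => Real.exp (∫ t in a..x, m t))
      (fun x => Real.exp (∫ t in a..x, m t) * m x) :=
    hM.comp (G := Real.exp) (G' := Real.exp) (s := univ) (fun _ _ => mem_univ _)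
      Real.contDiff_exp.contDiffOn (fun y _ => Real.hasDerivAt_exp y)
  have hE2 : ACD a (fun x => Real.exp (-∫ t in a..x, m t))
      (fun x => -Real.exp (-∫ t in a..x, m t) * m x) :=
    hM.comp (G := fun y => Real.exp (-y)) (G' := fun y => -Real.exp (-y)) (s := univ)
      (fun _ _ => mem_univ _)
      (Real.contDiff_exp.comp contDiff_neg).contDiffOn
      (fun y _ => by simpa using (hasDerivAt_neg y).exp)
  constructor
  · have := (h.mul hE).le_of_nonneg (fun x hx => by
      have h1 := (abs_le.1 (hb x hx)).1
      have h2 := Real.exp_pos (∫ t in a..x, m t)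
      nlinarith) hab
    simpa using this
  · have := ((const (a := a) 0).sub (h.mul hE2)).le_of_nonneg (fun x hx => by
      have h1 := (abs_le.1 (hb x hx)).2
      have h2 := Real.exp_pos (-∫ t in a..x, m t)
      nlinarith) hab
    have h3 : f b * Real.exp (-∫ t in a..b, m t) ≤ f a := by simpa using this
    rw [Real.exp_neg, ← div_eq_mul_inv, div_le_iff₀ (Real.exp_pos _)] at h3
    exact h3

lemma tendsto (h : ACD a f f') (hi : IntegrableOn f' (Ioi a)) :
    ∃ l, Tendsto f atTop (nhds l) := by
  refine ⟨f a + ∫ t in Ioi a, f' t, ?_⟩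
  have h1 := (intervalIntegral_tendsto_integral_Ioi a hi tendsto_id).const_add (f a)
  refine h1.congr' ?_
  filter_upwards [eventually_ge_atTop a] with x hx
  exact (h.eq x hx).symm

end ACD

/-- Nontrivial solutions do not vanish together with their quasi-derivative. -/
lemma sol_nonvanish {p c u v : ℝ → ℝ} (hu : ACD 0 u (fun x => v x / p x))
    (hv : ACD 0 v (fun x => c x * u x)) (hp : ∀ x, 0 ≤ x → 0 < p x)
    (hpc : ContinuousOn p (Ici 0)) (hc : ∀ b, 0 ≤ b → IntervalIntegrable c volume 0 b)
    (h0 : v 0 ≠ 0) {X : ℝ} (hX : 0 ≤ X) : 0 < u X * u X + v X * v X := by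
  have hE := (hu.mul hu).add (hv.mul hv)
  have hm : ∀ b, 0 ≤ b → IntervalIntegrable (fun x => (p x)⁻¹ + |c x|) volume 0 b := by
    intro b hb
    refine IntervalIntegrable.add ?_ (hc b hb).abs
    refine ContinuousOn.intervalIntegrable ?_
    rw [uIcc_of_le hb]
    refine (hpc.mono Icc_subset_Ici_self).inv₀ fun x hx => (hp x hx.1).ne'
  have := (hE.gronwall hm (fun x hx => by
    have hpx := hp x hx
    have e : v x / p x * u x + u x * (v x / p x) + (c x * u x * v x + v x * (c x * u x))
      = ((p x)⁻¹ + c x) * (2 * (u x * v x)) := by field_simp; ring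
    rw [e, abs_mul]
    refine mul_le_mul ?_ ?_ (abs_nonneg _) (by positivity)
    · refine (abs_add_le _ _).trans ?_
      rw [abs_of_pos (inv_pos.2 hpx)]
    · rw [abs_le]; constructor <;> nlinarith [sq_nonneg (u x + v x), sq_nonneg (u x - v x)]) hX).1
  have h2 : 0 < v 0 * v 0 := mul_self_pos.2 h0
  have h3 : 0 ≤ u 0 * u 0 := mul_self_nonneg _
  by_contra hcon
  push Not at hcon
  have h4 := Real.exp_pos (∫ t in (0:ℝ)..X, ((p t)⁻¹ + |c t|))
  nlinarith [mul_nonneg (sub_nonneg.2 hcon) h4.le]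

lemma bdd_integrable {a C : ℝ} {f g : ℝ → ℝ} (hf : IntegrableOn f (Ioi a))
    (hg : ContinuousOn g (Ici a)) (hb : ∀ x, a ≤ x → |g x| ≤ C) :
    IntegrableOn (fun x => g x * f x) (Ioi a) := by
  refine Integrable.bdd_mul (c := C) hf ?_ ?_
  · exact (hg.mono Ioi_subset_Ici_self).aestronglyMeasurable measurableSet_Ioi
  · rw [ae_restrict_iff' measurableSet_Ioi]
    exact Eventually.of_forall fun x hx => hb x (le_of_lt hx)

/-- Core asymptotic statement. -/
lemma core {X : ℝ} {w v k ρ F : ℝ → ℝ} (hw : ACD X w (fun x => ρ x * w x + k x * v x))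
    (hv : ACD X v (fun x => -(k x * w x))) (hF : ACD X F k) (hρ : IntegrableOn ρ (Ioi X))
    (h0 : 0 < v X * v X + w X * w X) :
    ∃ D η : ℝ, 0 < D ∧ Tendsto (fun x => w x - D * Real.sin (F x - η)) atTop (nhds 0) := by
  have hsin := hF.comp (G := Real.sin) (G' := Real.cos) (s := univ) (fun _ _ => mem_univ _)
    Real.contDiff_sin.contDiffOn (fun y _ => Real.hasDerivAt_sin y)
  have hcos := hF.comp (G := Real.cos) (G' := fun y => -Real.sin y) (s := univ)
    (fun _ _ => mem_univ _) Real.contDiff_cos.contDiffOn (fun y _ => Real.hasDerivAt_cos y)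
  have hA : ACD X (fun x => v x * Real.cos (F x) + w x * Real.sin (F x))
      (fun x => (w x * Real.sin (F x)) * ρ x) :=
    ((hv.mul hcos).add (hw.mul hsin)).congr (fun _ _ => rfl) (fun x _ => by ring)
  have hB : ACD X (fun x => w x * Real.cos (F x) - v x * Real.sin (F x))
      (fun x => (w x * Real.cos (F x)) * ρ x) :=
    ((hw.mul hcos).sub (hv.mul hsin)).congr (fun _ _ => rfl) (fun x _ => by ring)
  have hS : ACD X (fun x => v x * v x + w x * w x) (fun x => 2 * ρ x * (w x * w x)) :=
    ((hv.mul hv).add (hw.mul hw)).congr (fun _ _ => rfl) (fun x _ => by ring)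
  have hm : IntegrableOn (fun x => 2 * |ρ x|) (Ioi X) := (Integrable.abs hρ).const_mul 2
  have hmi : ∀ b, X ≤ b → IntervalIntegrable (fun x => 2 * |ρ x|) volume X b := by
    intro b hb
    rw [intervalIntegrable_iff_integrableOn_Ioc_of_le hb]
    exact hm.mono_set Ioc_subset_Ioi_self
  set M := ∫ t in Ioi X, 2 * |ρ t| with hMdef
  have hMle : ∀ b, X ≤ b → ∫ t in X..b, 2 * |ρ t| ≤ M := by
    intro b hb
    rw [intervalIntegral.integral_of_le hb]
    refine setIntegral_mono_set hm (Eventually.of_forall fun x => by positivity) ?_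
    exact (Ioc_subset_Ioi_self).eventuallyLE
  have hG := fun b (hb : X ≤ b) => hS.gronwall hmi (fun x _ => by
      rw [abs_mul, abs_mul, abs_of_pos (two_pos : (0:ℝ) < 2), abs_mul_self]
      gcongr
      nlinarith [mul_self_nonneg (v x)]) hb
  set S0 := v X * v X + w X * w X with hS0
  have hlow : ∀ b, X ≤ b → S0 ≤ (v b * v b + w b * w b) * Real.exp M := fun b hb =>
    (hG b hb).1.trans (by
      refine mul_le_mul_of_nonneg_left (Real.exp_le_exp.2 (hMle b hb)) ?_
      nlinarith [mul_self_nonneg (v b), mul_self_nonneg (w b)])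
  have hup : ∀ b, X ≤ b → (v b * v b + w b * w b) ≤ S0 * Real.exp M := fun b hb =>
    (hG b hb).2.trans (mul_le_mul_of_nonneg_left (Real.exp_le_exp.2 (hMle b hb)) h0.le)
  have hwb : ∀ b, X ≤ b → |w b| ≤ 1 + S0 * Real.exp M := fun b hb => by
    have := hup b hb
    rw [abs_le]; constructor <;>
    nlinarith [mul_self_nonneg (v b), mul_self_nonneg (w b), sq_nonneg (w b - 1),
      sq_nonneg (w b + 1)]
  obtain ⟨A, hAl⟩ := hA.tendsto (bdd_integrable (C := 1 + S0 * Real.exp M) hρ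
    (hw.cont.mul hsin.cont) (fun x hx => by
      rw [abs_mul]
      have := Real.abs_sin_le_one (F x)
      nlinarith [hwb x hx, abs_nonneg (w x)]))
  obtain ⟨B, hBl⟩ := hB.tendsto (bdd_integrable (C := 1 + S0 * Real.exp M) hρ
    (hw.cont.mul hcos.cont) (fun x hx => by
      rw [abs_mul]
      have := Real.abs_cos_le_one (F x)
      nlinarith [hwb x hx, abs_nonneg (w x)]))
  have hAB : S0 ≤ (A * A + B * B) * Real.exp M := by
    refine ge_of_tendsto (((hAl.mul hAl).add (hBl.mul hBl)).mul_const (Real.exp M)) ?_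
    filter_upwards [eventually_ge_atTop X] with x hx
    refine (hlow x hx).trans (le_of_eq ?_)
    have := Real.sin_sq_add_cos_sq (F x)
    linear_combination (-(v x * v x + w x * w x) * Real.exp M) * this
  have hABpos : 0 < A * A + B * B := by
    by_contra hcon
    push Not at hcon
    nlinarith [mul_nonneg (sub_nonneg.2 hcon) (Real.exp_pos M).le]
  let z : ℂ := ⟨A, -B⟩
  have hz : z ≠ 0 := by
    intro h
    have h1 : A = 0 := congrArg Complex.re h
    have h2 : -B = 0 := congrArg Complex.im h
    have h3 : B = 0 := by linarith
    rw [h1, h3] at hABpos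
    simp at hABpos
  have hre : ‖z‖ * Real.cos z.arg = A := Complex.norm_mul_cos_arg z
  have him : ‖z‖ * Real.sin z.arg = -B := Complex.norm_mul_sin_arg z
  refine ⟨‖z‖, z.arg, norm_pos_iff.2 hz, ?_⟩
  have e : ∀ x, w x - ‖z‖ * Real.sin (F x - z.arg) =
      Real.sin (F x) * ((v x * Real.cos (F x) + w x * Real.sin (F x)) - A) +
      Real.cos (F x) * ((w x * Real.cos (F x) - v x * Real.sin (F x)) - B) := by
    intro x
    rw [Real.sin_sub]
    have := Real.sin_sq_add_cos_sq (F x)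
    linear_combination (-w x) * this - Real.sin (F x) * hre + Real.cos (F x) * him
  simp_rw [e]
  have hA0 : Tendsto (fun x => (v x * Real.cos (F x) + w x * Real.sin (F x)) - A) atTop (nhds 0) := by
    simpa using hAl.sub_const A
  have hB0 : Tendsto (fun x => (w x * Real.cos (F x) - v x * Real.sin (F x)) - B) atTop (nhds 0) := by
    simpa using hBl.sub_const B
  have h1 := bdd_le_mul_tendsto_zero' (f := fun x => Real.sin (F x)) 1
    (Eventually.of_forall fun x => Real.abs_sin_le_one (F x)) hA0
  have h2 := bdd_le_mul_tendsto_zero' (f := fun x => Real.cos (F x)) 1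
    (Eventually.of_forall fun x => Real.abs_cos_le_one (F x)) hB0
  simpa using h1.add h2

/-- the regular (real-valued) solution `φ` with `φ(0) = 0`, `φ'(0) = 1`
has the asymptotics `φ(x) = (κ/(√(p₀λ) K(λ))) sin(Φ(x,λ) − η) + o(1)` as `x → ∞`
for some constants `κ > 0` and `η ∈ ℝ`. -/
theorem statement13 (p p' q q' : ℝ → ℝ) (p₀ x₀ : ℝ)
    (hPQ : PQData p p' q q' p₀ x₀)
    (lam : ℝ) (hlam : 0 < lam)
    (φ φ' : ℝ → ℝ)
    (hsol : IsSol p q (lam : ℂ) (Ici 0)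
      (fun x => (φ x : ℂ)) (fun x => (φ' x : ℂ)))
    (h0 : φ 0 = 0) (h0' : φ' 0 = 1) :
    ∃ κ η : ℝ, 0 < κ ∧
      Tendsto (fun x =>
          φ x - κ / (Real.sqrt (p₀ * lam) * Kc p q lam)
            * Real.sin (Phi p q lam x - η))
        atTop (nhds 0) := by
  obtain ⟨hp_pos, hp₀, hx₀, hp_ac, hp'i, hp_lim, hq_i, hq_ac, hq'i, hq_lim⟩ := hPQ
  have hp : ACD 0 p p' := ⟨fun b hb => by
    rw [intervalIntegrable_iff_integrableOn_Ioc_of_le hb]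
    exact hp'i.mono_set Ioc_subset_Ioi_self, hp_ac⟩
  have hq : ACD x₀ q q' := ⟨fun b hb => by
    rw [intervalIntegrable_iff_integrableOn_Ioc_of_le hb]
    exact hq'i.mono_set Ioc_subset_Ioi_self, hq_ac⟩
  have hqi : ∀ b, 0 ≤ b → IntervalIntegrable q volume 0 b := by
    intro b hb
    have h1 : IntervalIntegrable q volume 0 x₀ := by
      rw [intervalIntegrable_iff_integrableOn_Ioo_of_le hx₀]
      exact hq_i
    have hb' : x₀ ≤ max x₀ b := le_max_left _ _
    have h2 : IntervalIntegrable q volume x₀ (max x₀ b) := by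
      refine ContinuousOn.intervalIntegrable ?_
      rw [uIcc_of_le hb']
      exact hq.cont.mono Icc_subset_Ici_self
    refine (h1.trans h2).mono_set ?_
    rw [uIcc_of_le hb, uIcc_of_le (hx₀.trans hb')]
    exact Icc_subset_Icc_right (le_max_right _ _)
  have hci : ∀ b, 0 ≤ b → IntervalIntegrable (fun x => q x - lam) volume 0 b := fun b hb =>
    (hqi b hb).sub intervalIntegrable_const
  have hφd : ∀ x ∈ Ici (0:ℝ), HasDerivWithinAt φ (φ' x) (Ici 0) x := by
    intro x hx
    have h1 := hsol.1 x hx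
    have h2 := (Complex.reCLM.hasFDerivAt (x := (φ x : ℂ))).comp_hasDerivWithinAt x h1
    simpa [Function.comp_def] using h2
  have hφc : ContinuousOn φ (Ici 0) := fun x hx => (hφd x hx).continuousWithinAt
  set v : ℝ → ℝ := fun x => p x * φ' x with hvdef
  have hv : ACD 0 v (fun x => (q x - lam) * φ x) := by
    refine ⟨fun b hb => (hci b hb).mul_continuousOn ?_, fun x hx => ?_⟩
    · rw [uIcc_of_le hb]
      exact hφc.mono Icc_subset_Ici_self
    · have h1 := hsol.2 0 (mem_Ici.2 le_rfl) x hx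
      have h2 : (∫ t in (0:ℝ)..x, ((q t : ℂ) - (lam : ℂ)) * (φ t : ℂ))
          = ((∫ t in (0:ℝ)..x, (q t - lam) * φ t : ℝ) : ℂ) := by
        rw [← intervalIntegral.integral_ofReal]
        push_cast
        rfl
      rw [h2] at h1
      beta_reduce at h1
      have h3 : p x * φ' x - p 0 * φ' 0 = ∫ t in (0:ℝ)..x, (q t - lam) * φ t := by
        exact_mod_cast h1
      simp only [hvdef]
      linarith
  have hu : ACD 0 φ (fun x => v x / p x) := by
    have hdc : ContinuousOn (fun x => v x / p x) (Ici 0) :=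
      hv.cont.div hp.cont fun x hx => (hp_pos x hx).ne'
    have hint : ∀ b, 0 ≤ b → IntervalIntegrable (fun x => v x / p x) volume 0 b := by
      intro b hb
      refine ContinuousOn.intervalIntegrable ?_
      rw [uIcc_of_le hb]
      exact hdc.mono Icc_subset_Ici_self
    refine ⟨hint, fun x hx => ?_⟩
    rw [intervalIntegral.integral_eq_sub_of_hasDerivAt_of_le hx
      (hφc.mono Icc_subset_Ici_self) ?_ (hint x hx)]
    · ring
    · intro y hy
      have h1 := (hφd y hy.1.le).hasDerivAt (Ici_mem_nhds hy.1)
      have h2 : v y / p y = φ' y := by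
        simp only [hvdef]
        rw [mul_div_cancel_left₀ _ (hp_pos y hy.1.le).ne']
      rw [h2]
      exact h1
  -- choice of the matching point
  have hev : ∀ᶠ x in atTop, x₀ ≤ x ∧ q x ≤ lam / 2 ∧ p₀ / 2 ≤ p x := by
    filter_upwards [eventually_ge_atTop x₀, hq_lim.eventually_le_const (half_pos hlam),
      hp_lim.eventually_const_le (half_lt_self hp₀)] with x h1 h2 h3
    exact ⟨h1, h2, h3⟩
  obtain ⟨X, hX⟩ := eventually_atTop.1 hev
  have hXx : x₀ ≤ X := (hX X le_rfl).1
  have hX0 : 0 ≤ X := hx₀.trans hXx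
  have hpos := sol_nonvanish hu hv hp_pos hp.cont hci
    (by simp only [hvdef, h0', mul_one]; exact (hp_pos 0 le_rfl).ne') hX0
  have hlq : ∀ x, X ≤ x → 0 < lam - q x := fun x hx => by
    have := (hX x hx).2.1
    linarith
  have hpp : ∀ x, X ≤ x → 0 < p x := fun x hx => hp_pos x (hX0.trans hx)
  have hL : ACD X (fun x => lam - q x) (fun x => 0 - q' x) := (ACD.const lam).sub (hq.mono hXx)
  have hpX := hp.mono hX0
  have hR := hL.mul hpX
  have hRpos : ∀ x, X ≤ x → 0 < (lam - q x) * p x := fun x hx => mul_pos (hlq x hx) (hpp x hx)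
  set r : ℝ → ℝ := fun x => Real.sqrt ((lam - q x) * p x) with hrdef
  have hrpos : ∀ x, X ≤ x → 0 < r x := fun x hx => Real.sqrt_pos.2 (hRpos x hx)
  have hrsq : ∀ x, X ≤ x → r x * r x = (lam - q x) * p x := fun x hx =>
    Real.mul_self_sqrt (hRpos x hx).le
  set ρ : ℝ → ℝ := fun x => (1/2) * (p x)⁻¹ * p' x - (1/2) * (lam - q x)⁻¹ * q' x with hρdef
  have hr : ACD X r (fun x => ρ x * r x) := by
    refine (hR.comp (G := Real.sqrt) (G' := fun y => 1 / (2 * Real.sqrt y)) (s := Ioi 0)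
      (fun x hx => hRpos x hx) ?_ ?_).congr (fun _ _ => rfl) ?_
    · intro y hy
      exact (Real.contDiffAt_sqrt (ne_of_gt hy)).contDiffWithinAt
    · intro y hy
      exact Real.hasDerivAt_sqrt (ne_of_gt hy)
    · intro x hx
      change ρ x * r x = 1 / (2 * r x) * _
      have h1 := hrpos x hx
      have h2 := hlq x hx
      have h3 := hpp x hx
      have h4 := hrsq x hx
      rw [one_div, eq_inv_mul_iff_mul_eq₀ (by positivity)]
      have h5 : 2 * r x * (ρ x * r x) = 2 * ρ x * ((lam - q x) * p x) := by rw [← h4]; ring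
      rw [h5, hρdef]
      field_simp
      ring
  have hρi : IntegrableOn ρ (Ioi X) := by
    have h1 := bdd_integrable (C := (1/2) * (p₀/2)⁻¹) (hp'i.mono_set (Ioi_subset_Ioi hX0))
      (g := fun x => (1/2) * (p x)⁻¹)
      (continuousOn_const.mul (hpX.cont.inv₀ fun x hx => (hpp x hx).ne')) (fun x hx => by
        have := hpp x hx
        rw [abs_of_pos (by positivity)]
        gcongr
        exact (hX x hx).2.2)
    have h2 := bdd_integrable (C := (1/2) * (lam/2)⁻¹) (hq'i.mono_set (Ioi_subset_Ioi hXx))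
      (g := fun x => (1/2) * (lam - q x)⁻¹)
      (continuousOn_const.mul (hL.cont.inv₀ fun x hx => (hlq x hx).ne')) (fun x hx => by
        have := hlq x hx
        rw [abs_of_pos (by positivity)]
        gcongr
        have := (hX x hx).2.1
        linarith)
    exact Integrable.sub h1 h2
  set k : ℝ → ℝ := fun x => Real.sqrt (max ((lam - q x) / p x) 0) with hkdef
  have hF0 : ACD 0 (Phi p q lam) k := by
    refine ⟨fun b hb => ?_, fun x hx => by simp [Phi, hkdef]⟩
    have h1 : IntervalIntegrable (fun x => (lam - q x) / p x) volume 0 b := by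
      have h2 : IntervalIntegrable (fun x => (lam - q x) * (p x)⁻¹) volume 0 b := by
        refine (intervalIntegrable_const.sub (hqi b hb)).mul_continuousOn ?_
        rw [uIcc_of_le hb]
        exact (hp.cont.mono Icc_subset_Ici_self).inv₀ fun x hx => (hp_pos x hx.1).ne'
      simpa [div_eq_mul_inv] using h2
    have h3 : IntervalIntegrable (fun x => 1 + |(lam - q x) / p x|) volume 0 b :=
      intervalIntegrable_const.add h1.abs
    refine h3.mono_fun ?_ ?_
    · have hc : Continuous fun y : ℝ => Real.sqrt (max y 0) := by fun_prop
      exact hc.comp_aestronglyMeasurable h1.aestronglyMeasurable_restrict_uIoc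
    · refine Eventually.of_forall fun x => ?_
      simp only [hkdef, Real.norm_eq_abs]
      rw [abs_of_nonneg (Real.sqrt_nonneg _), abs_of_nonneg (by positivity)]
      refine Real.sqrt_le_iff.2 ⟨by positivity, ?_⟩
      refine max_le ?_ (by positivity)
      nlinarith [le_abs_self ((lam - q x) / p x), abs_nonneg ((lam - q x) / p x)]
  have hF := hF0.mono hX0
  have hk : ∀ x, X ≤ x → k x = r x / p x := by
    intro x hx
    have h1 := hlq x hx
    have h3 := hpp x hx
    have h4 := hrsq x hx
    have h2 := hrpos x hx
    simp only [hkdef]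
    rw [max_eq_left (by positivity), Real.sqrt_eq_iff_mul_self_eq (by positivity) (by positivity)]
    field_simp
    nlinarith
  have hw : ACD X (fun x => r x * φ x)
      (fun x => ρ x * (r x * φ x) + k x * v x) :=
    (hr.mul (hu.mono hX0)).congr (fun _ _ => rfl) (fun x hx => by
      rw [hk x hx]; ring)
  have hvX : ACD X v (fun x => -(k x * (r x * φ x))) :=
    (hv.mono hX0).congr (fun _ _ => rfl) (fun x hx => by
      rw [hk x hx]
      have h3 := hpp x hx
      have h4 := hrsq x hx
      have : r x / p x * (r x * φ x) = (lam - q x) * φ x := by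
        field_simp
        linear_combination φ x * h4
      rw [this]; ring)
  have hstart : 0 < v X * v X + (r X * φ X) * (r X * φ X) := by
    have h2 := hrpos X le_rfl
    by_cases hφX : φ X = 0
    · rw [hφX] at hpos ⊢
      simpa using hpos
    · have : 0 < (r X * φ X) * (r X * φ X) := mul_self_pos.2 (mul_ne_zero h2.ne' hφX)
      nlinarith [mul_self_nonneg (v X)]
  obtain ⟨D, η, hD, hlim⟩ := core hw hvX hF hρi hstart
  have hK : 0 < Kc p q lam := Real.exp_pos _
  have hr0 : 0 < Real.sqrt (p₀ * lam) := Real.sqrt_pos.2 (mul_pos hp₀ hlam)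
  refine ⟨D * Kc p q lam, η, mul_pos hD hK, ?_⟩
  have hrlim : Tendsto r atTop (nhds (Real.sqrt (p₀ * lam))) := by
    have h1 := ((hq_lim.const_sub lam).mul hp_lim).sqrt
    rwa [sub_zero, mul_comm lam p₀] at h1
  have hrinv := hrlim.inv₀ hr0.ne'
  have hrinv0 : Tendsto (fun x => (r x)⁻¹ - (Real.sqrt (p₀ * lam))⁻¹) atTop (nhds 0) := by
    simpa using hrinv.sub_const (Real.sqrt (p₀ * lam))⁻¹
  have h1 := hlim.mul hrinv
  have h2 := bdd_le_mul_tendsto_zero' (f := fun x => D * Real.sin (Phi p q lam x - η)) D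
    (Eventually.of_forall fun x => by
      rw [abs_mul, abs_of_pos hD]
      have := Real.abs_sin_le_one (Phi p q lam x - η)
      nlinarith) hrinv0
  have h3 := h1.add h2
  rw [zero_mul, zero_add] at h3
  refine h3.congr' ?_
  filter_upwards [eventually_ge_atTop X] with x hx
  have h4 := hrpos x hx
  field_simp
  ring

end
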